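/- arXiv:1909.04918 — 2 statements merged into one kernel-verified Lean document; each statement's English description precedes it below -/
import Mathlib

section
/- There exists an absolute constant K > 0 with the following property. Let p ≥ 1 be an integer and let f(z) = ∑_{k=0}^∞ a_k z^k be an analytic function on the open unit disk D_1 = {z ∈ ℂ : |z| < 1} which is p-valent in D_1 (for every c ∈ ℂ the equation f(z) = c has at most p solutions in D_1, counted with multiplicity). Then for every real R > 1 and every R' with 0 < R' < R, the Borel transform B(f)(z) = ∑_{k=0}^∞ (a_k/k!) z^k, which is an entire function, is q-valent in the disk D_{R'} = {z : |z| < R'} in the sense that for every c ∈ ℂ the set {z : |z| < R', B(f)(z) = c} has at most q elements, where q = ⌈K·((1 + log p + log R)·p + R)⌉ (log denoting natural logarithm). -/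
open Set MeasureTheory Filter Topology

theorem hasFPowerSeriesOnBall_ofScalars_of_hasSum {a : ℕ → ℂ} {f : ℂ → ℂ} {ρ : ℝ} (hρ : 0 < ρ)
    (h : ∀ z ∈ Metric.ball (0 : ℂ) ρ, HasSum (fun k : ℕ => a k * z ^ k) (f z)) :
    HasFPowerSeriesOnBall f (FormalMultilinearSeries.ofScalars ℂ a) 0 (ENNReal.ofReal ρ) where
  r_le := by
    refine ENNReal.le_of_forall_nnreal_lt fun r hr => ?_
    have hr' : (r : ℝ) < ρ := by
      rw [← ENNReal.ofReal_coe_nnreal] at hr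
      exact (ENNReal.ofReal_lt_ofReal_iff hρ).1 hr
    refine FormalMultilinearSeries.le_radius_of_summable_norm _ ?_
    have hs := (h (r : ℂ) (by simpa using hr')).summable.norm
    simpa [FormalMultilinearSeries.ofScalars_norm] using hs
  r_pos := by simpa using hρ
  hasSum := by
    intro y hy
    have hy' : y ∈ Metric.ball (0 : ℂ) ρ := by
      rw [← Metric.eball_ofReal]; exact hy
    simpa [FormalMultilinearSeries.ofScalars_apply_eq, mul_comm] using h y hy'

theorem differentiableOn_of_hasSum {a : ℕ → ℂ} {f : ℂ → ℂ} {ρ : ℝ} (hρ : 0 < ρ)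
    (h : ∀ z ∈ Metric.ball (0 : ℂ) ρ, HasSum (fun k : ℕ => a k * z ^ k) (f z)) :
    DifferentiableOn ℂ f (Metric.ball 0 ρ) := by
  have := (hasFPowerSeriesOnBall_ofScalars_of_hasSum hρ h).differentiableOn
  rwa [Metric.eball_ofReal] at this

theorem iteratedDeriv_zero_of_hasSum {a : ℕ → ℂ} {f : ℂ → ℂ} {ρ : ℝ} (hρ : 0 < ρ)
    (h : ∀ z ∈ Metric.ball (0 : ℂ) ρ, HasSum (fun k : ℕ => a k * z ^ k) (f z)) (n : ℕ) :
    iteratedDeriv n f 0 = n.factorial * a n := by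
  have := (hasFPowerSeriesOnBall_ofScalars_of_hasSum hρ h).factorial_smul 1 n
  rw [iteratedDeriv_eq_iteratedFDeriv, ← this]
  simp

/-- Cauchy's estimate for the coefficients of a power series. -/
theorem norm_coeff_le_of_hasSum {a : ℕ → ℂ} {f : ℂ → ℂ} {ρ r C : ℝ} (hr : 0 < r) (hrρ : r < ρ)
    (h : ∀ z ∈ Metric.ball (0 : ℂ) ρ, HasSum (fun k : ℕ => a k * z ^ k) (f z))
    (hC : ∀ z : ℂ, ‖z‖ = r → ‖f z‖ ≤ C) (n : ℕ) : ‖a n‖ ≤ C / r ^ n := by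
  have hρ := hr.trans hrρ
  have hd := differentiableOn_of_hasSum hρ h
  have h1 := Complex.norm_iteratedDeriv_le_of_forall_mem_sphere_norm_le n hr
    ((hd.mono (Metric.closedBall_subset_ball hrρ)).diffContOnCl_ball subset_rfl)
    (fun z hz => hC z (by simpa using hz))
  rw [iteratedDeriv_zero_of_hasSum hρ h, norm_mul, Complex.norm_natCast, mul_div_assoc] at h1
  exact le_of_mul_le_mul_left h1 (by positivity)

/-- A holomorphic function vanishing on a finite set is divisible by the corresponding product
of linear factors. -/
theorem exists_eq_prod_sub_mul {U : Set ℂ} (hU : IsOpen U) (S : Finset ℂ) :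
    ∀ {g : ℂ → ℂ}, DifferentiableOn ℂ g U → (∀ s ∈ S, s ∈ U ∧ g s = 0) →
      ∃ h : ℂ → ℂ, DifferentiableOn ℂ h U ∧ ∀ z, g z = (∏ s ∈ S, (z - s)) * h z := by
  induction S using Finset.induction_on with
  | empty => exact fun {g} hg _ => ⟨g, hg, by simp⟩
  | insert b S hb ih =>
    intro g hg hS
    have hbU := (hS b (Finset.mem_insert_self b S)).1
    have hgb := (hS b (Finset.mem_insert_self b S)).2
    have key : ∀ z, g z = (z - b) * dslope g b z := fun z => by
      have := sub_smul_dslope g b z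
      rw [hgb, sub_zero, smul_eq_mul] at this
      exact this.symm
    obtain ⟨h, hh, hgh⟩ := ih (g := dslope g b)
      ((Complex.differentiableOn_dslope (hU.mem_nhds hbU)).2 hg) (fun s hs => by
        have hs' := hS s (Finset.mem_insert_of_mem hs)
        refine ⟨hs'.1, ?_⟩
        have := key s
        rw [hs'.2] at this
        refine (mul_eq_zero.1 this.symm).resolve_left (sub_ne_zero.2 ?_)
        rintro rfl
        exact hb hs)
    exact ⟨h, hh, fun z => by rw [Finset.prod_insert hb, key, hgh, mul_assoc]⟩

theorem iteratedDeriv_card_prod_sub (S : Finset ℂ) (x : ℂ) :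
    iteratedDeriv S.card (fun z : ℂ => ∏ s ∈ S, (z - s)) x = S.card.factorial := by
  set P : Polynomial ℂ := ∏ s ∈ S, (Polynomial.X - Polynomial.C s) with hP
  have hmon : P.Monic := Polynomial.monic_prod_of_monic _ _ fun s _ => Polynomial.monic_X_sub_C s
  have hdeg : P.natDegree = S.card := by
    simp [hP, Polynomial.natDegree_prod_of_monic, Polynomial.monic_X_sub_C]
  have hfun : (fun z : ℂ => ∏ s ∈ S, (z - s)) = fun z => P.eval z := by
    ext z; simp [hP, Polynomial.eval_prod]
  have hit : ∀ n : ℕ, ∀ Q : Polynomial ℂ, iteratedDeriv n (fun z => Q.eval z) =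
      fun z => (Polynomial.derivative^[n] Q).eval z := by
    intro n
    induction n with
    | zero => intro Q; simp
    | succ n ih =>
      intro Q
      rw [iteratedDeriv_succ', Function.iterate_succ_apply, ← ih]
      congr 1
      ext z
      simp
  have hc : Polynomial.derivative^[S.card] P = Polynomial.C (S.card.factorial : ℂ) := by
    rw [Polynomial.eq_C_of_natDegree_le_zero (p := Polynomial.derivative^[S.card] P)
      ((Polynomial.natDegree_iterate_derivative _ _).trans (by rw [hdeg, Nat.sub_self]))]
    rw [Polynomial.coeff_iterate_derivative]
    have : P.coeff S.card = 1 := by rw [← hdeg]; exact hmon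
    simp [this, Nat.descFactorial_self]
  rw [hfun, hit, hc]
  simp

theorem abs_det_restrictScalars_smulRight (c : ℂ) :
    |((ContinuousLinearMap.toSpanSingleton ℂ c).restrictScalars ℝ : ℂ →L[ℝ] ℂ).det| = ‖c‖ ^ 2 := by
  have : ((ContinuousLinearMap.toSpanSingleton ℂ c).restrictScalars ℝ : ℂ →L[ℝ] ℂ).det
      = Complex.normSq c := by
    change LinearMap.det (((ContinuousLinearMap.toSpanSingleton ℂ c : ℂ →L[ℂ] ℂ) :
      ℂ →ₗ[ℂ] ℂ).restrictScalars ℝ) = _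
    rw [LinearMap.det_restrictScalars, Algebra.norm_complex_apply]
    congr 1
    simp
  rw [this, Complex.normSq_eq_norm_sq, abs_of_nonneg (by positivity)]

theorem exists_mem_nhds_injOn_of_deriv_ne_zero {F : ℂ → ℂ} {U : Set ℂ} (hU : IsOpen U)
    (hF : DifferentiableOn ℂ F U) {z : ℂ} (hz : z ∈ U) (h0 : deriv F z ≠ 0) :
    ∃ V ∈ 𝓝 z, IsOpen V ∧ InjOn F V := by
  have hs : HasStrictDerivAt F (deriv F z) z :=
    (hF.analyticAt (hU.mem_nhds hz)).hasStrictDerivAt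
  have hs' := (hs.hasStrictFDerivAt_equiv h0)
  refine ⟨(hs'.toOpenPartialHomeomorph F).source, ?_, (hs'.toOpenPartialHomeomorph F).open_source, ?_⟩
  · exact (hs'.toOpenPartialHomeomorph F).open_source.mem_nhds hs'.mem_toOpenPartialHomeomorph_source
  · have := (hs'.toOpenPartialHomeomorph F).injOn
    simpa using this

/-- Change of variables for a holomorphic map taking every value at most `p` times. -/
theorem lintegral_norm_deriv_sq_mul_comp_le {F : ℂ → ℂ} {U A : Set ℂ} (hU : IsOpen U)
    (hF : DifferentiableOn ℂ F U) (hAU : A ⊆ U) (hA : MeasurableSet A) (p : ℕ)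
    (hp : ∀ (c : ℂ) (s : Finset ℂ), (∀ z ∈ s, z ∈ A ∧ F z = c) → s.card ≤ p)
    {φ : ℂ → ENNReal} (hφ : Measurable φ) :
    ∫⁻ z in A, ENNReal.ofReal (‖deriv F z‖ ^ 2) * φ (F z) ≤ p * ∫⁻ w, φ w := by
  classical
  have hdm : Measurable (deriv F) := measurable_deriv F
  set A' : Set ℂ := A ∩ {z | deriv F z ≠ 0} with hA'
  have hA'm : MeasurableSet A' := hA.inter (hdm (measurableSet_singleton 0).compl)
  have hred : ∫⁻ z in A, ENNReal.ofReal (‖deriv F z‖ ^ 2) * φ (F z)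
      ≤ ∫⁻ z in A', ENNReal.ofReal (‖deriv F z‖ ^ 2) * φ (F z) := by
    rw [← lintegral_indicator hA, ← lintegral_indicator hA'm]
    refine lintegral_mono fun z => ?_
    by_cases hz : z ∈ A
    · by_cases h0 : deriv F z = 0
      · simp [indicator, hz, h0]
      · simp [indicator, hz, h0, hA']
    · simp [indicator, hz]
  refine hred.trans ?_
  have hloc : ∀ z ∈ A', ∃ V ∈ 𝓝 z, IsOpen V ∧ InjOn F V := fun z hz =>
    exists_mem_nhds_injOn_of_deriv_ne_zero hU hF (hAU hz.1) hz.2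
  choose! V hV hVo hVi using hloc
  obtain ⟨t, htA, htc, htcov⟩ := TopologicalSpace.countable_cover_nhdsWithin
    (f := V) (s := A') (fun z hz => mem_nhdsWithin_of_mem_nhds (hV z hz))
  rcases t.eq_empty_or_nonempty with rfl | htne
  · have : A' = ∅ := by simpa using htcov
    simp [this]
  obtain ⟨e, rfl⟩ := htc.exists_eq_range htne
  have heA : ∀ n, e n ∈ A' := fun n => htA (mem_range_self n)
  set B : ℕ → Set ℂ := fun n => A' ∩ disjointed (fun n => V (e n)) n with hB
  have hBm : ∀ n, MeasurableSet (B n) := fun n =>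
    hA'm.inter (MeasurableSet.disjointed (fun n => (hVo _ (heA n)).measurableSet) n)
  have hBd : Pairwise (Function.onFun Disjoint B) := fun i j hij =>
    ((disjoint_disjointed (fun n => V (e n))) hij).mono inter_subset_right inter_subset_right
  have hBi : ∀ n, InjOn F (B n) := fun n =>
    (hVi _ (heA n)).mono (inter_subset_right.trans (disjointed_subset _ n))
  have hBU : A' = ⋃ n, B n := by
    rw [hB, ← inter_iUnion, iUnion_disjointed]
    refine (inter_eq_left.2 ?_).symm
    simpa using htcov
  have hder : ∀ n, ∀ x ∈ B n, HasFDerivWithinAt F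
      ((ContinuousLinearMap.toSpanSingleton ℂ (deriv F x)).restrictScalars ℝ : ℂ →L[ℝ] ℂ) (B n) x := by
    intro n x hx
    have hd := (hF.differentiableAt (hU.mem_nhds (hAU hx.1.1))).hasDerivAt
    exact (hd.hasFDerivAt.restrictScalars ℝ).hasFDerivWithinAt
  have himm : ∀ n, MeasurableSet (F '' B n) := fun n =>
    measurable_image_of_fderivWithin (hBm n) (hder n) (hBi n)
  have hpiece : ∀ n, ∫⁻ z in B n, ENNReal.ofReal (‖deriv F z‖ ^ 2) * φ (F z)
      = ∫⁻ w, (F '' B n).indicator 1 w * φ w := by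
    intro n
    have := lintegral_image_eq_lintegral_abs_det_fderiv_mul volume (hBm n) (hder n) (hBi n) φ
    simp only [abs_det_restrictScalars_smulRight] at this
    rw [← this, ← lintegral_indicator (himm n)]
    refine lintegral_congr fun w => ?_
    by_cases hw : w ∈ F '' B n <;> simp [indicator, hw]
  rw [hBU, lintegral_iUnion hBm hBd]
  simp_rw [hpiece]
  rw [← lintegral_tsum (f := fun n w => (F '' B n).indicator 1 w * φ w)
      (fun n => ((measurable_one.indicator (himm n)).mul hφ).aemeasurable),
    ← lintegral_const_mul _ hφ]
  refine lintegral_mono fun w => ?_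
  simp only
  rw [ENNReal.tsum_mul_right]
  gcongr
  rw [ENNReal.tsum_eq_iSup_sum]
  refine iSup_le fun s => ?_
  have : ∑ n ∈ s, (F '' B n).indicator (1 : ℂ → ENNReal) w
      = ((s.filter fun n => w ∈ F '' B n).card : ENNReal) := by
    rw [Finset.card_filter]
    push_cast
    exact Finset.sum_congr rfl fun n _ => by simp [indicator]
  rw [this]
  norm_cast
  set s' := s.filter fun n => w ∈ F '' B n with hs'
  have hex : ∀ n ∈ s', ∃ z ∈ B n, F z = w := fun n hn => (Finset.mem_filter.1 hn).2
  choose! g hgB hgw using hex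
  have hinj : InjOn g s' := by
    intro i hi j hj hij
    by_contra hne
    exact disjoint_left.1 (hBd hne) (hgB i hi) (hij ▸ hgB j hj)
  rw [← Finset.card_image_of_injOn hinj]
  refine hp w _ fun z hz => ?_
  obtain ⟨n, hn, rfl⟩ := Finset.mem_image.1 hz
  exact ⟨(hgB n hn).1.1, hgw n hn⟩

theorem sub_sq_le_mul_integral {v v' q : ℝ → ℝ} {T s t : ℝ} (hT : 0 < T)
    (hv : ∀ y, HasDerivAt v (v' y) y) (hq : Continuous q) (hvq : ∀ y, v' y ^ 2 ≤ q y)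
    (hs : s ∈ Icc 0 T) (ht : t ∈ Icc 0 T) :
    (v t - v s) ^ 2 ≤ T * ∫ y in (0 : ℝ)..T, q y := by
  rcases eq_or_ne (v t) (v s) with h0 | h0
  · rw [h0, sub_self]
    have : 0 ≤ ∫ y in (0 : ℝ)..T, q y :=
      intervalIntegral.integral_nonneg hT.le fun y _ => (sq_nonneg _).trans (hvq y)
    have : 0 ≤ T * ∫ y in (0 : ℝ)..T, q y := mul_nonneg hT.le this
    simpa using this
  set D := |v t - v s| with hD
  have hDpos : 0 < D := abs_pos.2 (sub_ne_zero.2 h0)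
  set l := D / T with hl
  have hlpos : 0 < l := by positivity
  set m : ℝ → ℝ := fun y => l / 2 + q y / (2 * l) with hm
  have hmc : Continuous m := by fun_prop
  have hvm : ∀ y, |v' y| ≤ m y := by
    intro y
    have h1 : |v' y| ^ 2 ≤ q y := by rw [sq_abs]; exact hvq y
    have h2 : |v' y| ≤ l / 2 + |v' y| ^ 2 / (2 * l) := by
      have : l / 2 + |v' y| ^ 2 / (2 * l) - |v' y| = (l - |v' y|) ^ 2 / (2 * l) := by
        field_simp; ring
      have h3 : 0 ≤ (l - |v' y|) ^ 2 / (2 * l) := by positivity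
      linarith
    calc |v' y| ≤ l / 2 + |v' y| ^ 2 / (2 * l) := h2
      _ ≤ l / 2 + q y / (2 * l) := by gcongr
  set M : ℝ → ℝ := fun y => ∫ x in (0 : ℝ)..y, m x with hM
  have hMd : ∀ y, HasDerivAt M (m y) y := fun y =>
    intervalIntegral.integral_hasDerivAt_right (hmc.intervalIntegrable _ _)
      (hmc.stronglyMeasurableAtFilter _ _) hmc.continuousAt
  have mono1 : Monotone (fun y => M y - v y) :=
    monotone_of_hasDerivAt_nonneg (fun y => (hMd y).sub (hv y)) fun y => by
      have := hvm y; have := le_abs_self (v' y); simp only [Pi.zero_apply]; linarith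
  have mono2 : Monotone (fun y => M y + v y) :=
    monotone_of_hasDerivAt_nonneg (fun y => (hMd y).add (hv y)) fun y => by
      have := hvm y; have := neg_abs_le (v' y); simp only [Pi.zero_apply]; linarith
  have mono3 : Monotone M :=
    monotone_of_hasDerivAt_nonneg hMd fun y => (abs_nonneg _).trans (hvm y)
  have key : D ≤ M T - M 0 := by
    have a1 := mono3 hs.1
    have a2 := mono3 hs.2
    have a3 := mono3 ht.1
    have a4 := mono3 ht.2
    rw [hD, abs_le]
    rcases le_total s t with hst | hst
    · have := mono1 hst
      have := mono2 hst
      simp only at *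
      constructor <;> linarith
    · have := mono1 hst
      have := mono2 hst
      simp only at *
      constructor <;> linarith
  have hM0 : M 0 = 0 := by simp [hM]
  have hMT : M T = T * (l / 2) + (∫ y in (0 : ℝ)..T, q y) / (2 * l) := by
    simp only [hM, hm]
    rw [intervalIntegral.integral_add (by simp)
      ((hq.div_const _).intervalIntegrable _ _), intervalIntegral.integral_div,
      intervalIntegral.integral_const, intervalIntegral.integral_div]
    simp only [sub_zero, smul_eq_mul]
    ring
  rw [hM0, hMT] at key
  rw [← sq_abs, ← hD]
  have hDl : D = l * T := by rw [hl]; field_simp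
  have h5 : l * T / 2 ≤ (∫ y in (0 : ℝ)..T, q y) / (2 * l) := by linarith
  rw [le_div_iff₀ (by positivity)] at h5
  rw [hDl]
  nlinarith

/-- The derivative of `log (1 + s) - log (B + s)`. -/
noncomputable def logRatioDeriv (B s : ℝ) : ℝ := 1 / (1 + s) - 1 / (B + s)

/-- The squared length of the gradient of `w ↦ log (1 + ‖w‖²) - log (B + ‖w‖²)`. -/
noncomputable def logRatioWeight (B : ℝ) (w : ℂ) : ℝ :=
  4 * ‖w‖ ^ 2 * logRatioDeriv B (‖w‖ ^ 2) ^ 2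

theorem hasDerivAt_logRatio {B s : ℝ} (hB : 1 ≤ B) (hs : 0 ≤ s) :
    HasDerivAt (fun s => Real.log (1 + s) - Real.log (B + s)) (logRatioDeriv B s) s := by
  have h1 : HasDerivAt (fun s : ℝ => 1 + s) 1 s := by simpa using (hasDerivAt_id s).const_add 1
  have h2 : HasDerivAt (fun s : ℝ => B + s) 1 s := by simpa using (hasDerivAt_id s).const_add B
  exact (h1.log (by positivity)).sub (h2.log (by positivity))

theorem logRatioDeriv_nonneg {B s : ℝ} (hB : 1 ≤ B) (hs : 0 ≤ s) : 0 ≤ logRatioDeriv B s := by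
  unfold logRatioDeriv
  have : 1 / (B + s) ≤ 1 / (1 + s) := by gcongr
  linarith

theorem mul_logRatioDeriv_le_one {B s : ℝ} (hB : 1 ≤ B) (hs : 0 ≤ s) :
    s * logRatioDeriv B s ≤ 1 := by
  unfold logRatioDeriv
  have h1 : s * (1 / (1 + s)) ≤ 1 := by
    rw [mul_one_div, div_le_one (by positivity)]; linarith
  have h2 : 0 ≤ s * (1 / (B + s)) := by positivity
  linarith [mul_sub s (1 / (1 + s)) (1 / (B + s))]

theorem continuous_logRatioWeight {B : ℝ} (hB : 1 ≤ B) : Continuous (logRatioWeight B) := by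
  unfold logRatioWeight logRatioDeriv
  have h1 : ∀ w : ℂ, 1 + ‖w‖ ^ 2 ≠ 0 := fun w => by positivity
  have h2 : ∀ w : ℂ, B + ‖w‖ ^ 2 ≠ 0 := fun w => by positivity
  fun_prop (disch := assumption)

theorem logRatioWeight_nonneg (B : ℝ) (w : ℂ) : 0 ≤ logRatioWeight B w := by
  unfold logRatioWeight; positivity

theorem lintegral_Ioi_le {B : ℝ} (hB : 1 ≤ B) :
    ∫⁻ r in Ioi (0 : ℝ), ENNReal.ofReal (4 * r * logRatioDeriv B (r ^ 2))
      ≤ ENNReal.ofReal (2 * Real.log B) := by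
  set G : ℝ → ℝ := fun r => 2 * (Real.log (1 + r ^ 2) - Real.log (B + r ^ 2)) with hG
  have hd : ∀ r, HasDerivAt G (4 * r * logRatioDeriv B (r ^ 2)) r := by
    intro r
    have h0 : HasDerivAt (fun r : ℝ => r ^ 2) (2 * r) r := by simpa using hasDerivAt_pow 2 r
    have h1 := HasDerivAt.comp (h := fun r : ℝ => r ^ 2) r (hasDerivAt_logRatio hB (sq_nonneg r)) h0
    have h2 := h1.const_mul 2
    have h3 : HasDerivAt G (2 * (logRatioDeriv B (r ^ 2) * (2 * r))) r := h2
    rwa [show 2 * (logRatioDeriv B (r ^ 2) * (2 * r)) = 4 * r * logRatioDeriv B (r ^ 2) by ring]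
      at h3
  have hnn : ∀ r ∈ Ioi (0 : ℝ), 0 ≤ 4 * r * logRatioDeriv B (r ^ 2) := fun r hr => by
    have := logRatioDeriv_nonneg hB (sq_nonneg r)
    have hr' : (0 : ℝ) < r := hr
    positivity
  have hlim : Tendsto G atTop (𝓝 0) := by
    have h1 : Tendsto (fun r : ℝ => B + r ^ 2) atTop atTop :=
      tendsto_atTop_add_const_left _ _ (tendsto_pow_atTop (by norm_num))
    have h2 : Tendsto (fun r : ℝ => 1 - (B - 1) * (B + r ^ 2)⁻¹) atTop (𝓝 1) := by
      simpa using (h1.inv_tendsto_atTop.const_mul (B - 1)).const_sub 1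
    have h3 := ((Real.continuousAt_log one_ne_zero).tendsto.comp h2).const_mul 2
    simp only [Real.log_one, mul_zero] at h3
    refine h3.congr fun r => ?_
    have hb : B + r ^ 2 ≠ 0 := by positivity
    simp only [hG, Function.comp]
    rw [← Real.log_div (by positivity) hb]
    congr 2
    field_simp
    ring
  have hc : ContinuousWithinAt G (Ici 0) 0 := (hd 0).continuousAt.continuousWithinAt
  have hint := integrableOn_Ioi_deriv_of_nonneg hc (fun r _ => hd r) hnn hlim
  have hval := integral_Ioi_of_hasDerivAt_of_nonneg hc (fun r _ => hd r) hnn hlim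
  rw [← ofReal_integral_eq_lintegral_ofReal hint
    ((ae_restrict_iff' measurableSet_Ioi).2 (ae_of_all _ hnn)), hval]
  simp [hG]

theorem lintegral_logRatioWeight_le {B : ℝ} (hB : 1 ≤ B) :
    ∫⁻ w, ENNReal.ofReal (logRatioWeight B w) ≤ ENNReal.ofReal (4 * Real.pi * Real.log B) := by
  rw [← Complex.lintegral_comp_polarCoord_symm]
  have hle : ∫⁻ p in polarCoord.target, ENNReal.ofReal p.1 •
      ENNReal.ofReal (logRatioWeight B (Complex.polarCoord.symm p)) ≤
      ∫⁻ p in polarCoord.target, ENNReal.ofReal (4 * p.1 * logRatioDeriv B (p.1 ^ 2)) := by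
    refine setLIntegral_mono' polarCoord.open_target.measurableSet fun p hp => ?_
    have hp1 : 0 < p.1 := by
      rw [polarCoord_target] at hp; exact hp.1
    rw [smul_eq_mul, ← ENNReal.ofReal_mul hp1.le]
    refine ENNReal.ofReal_le_ofReal ?_
    unfold logRatioWeight
    rw [Complex.norm_polarCoord_symm, sq_abs]
    have h1 := mul_logRatioDeriv_le_one hB (sq_nonneg p.1)
    have h2 := logRatioDeriv_nonneg hB (sq_nonneg p.1)
    calc p.1 * (4 * p.1 ^ 2 * logRatioDeriv B (p.1 ^ 2) ^ 2)
        = 4 * p.1 * logRatioDeriv B (p.1 ^ 2) * (p.1 ^ 2 * logRatioDeriv B (p.1 ^ 2)) := by ring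
      _ ≤ 4 * p.1 * logRatioDeriv B (p.1 ^ 2) * 1 := by gcongr
      _ = _ := by ring
  refine hle.trans ?_
  have hmeas : Measurable fun r : ℝ => ENNReal.ofReal (4 * r * logRatioDeriv B (r ^ 2)) := by
    unfold logRatioDeriv; fun_prop
  rw [polarCoord_target, Measure.volume_eq_prod, ← Measure.prod_restrict,
    lintegral_prod (fun p : ℝ × ℝ => ENNReal.ofReal (4 * p.1 * logRatioDeriv B (p.1 ^ 2)))
      (hmeas.comp measurable_fst).aemeasurable]
  simp only [lintegral_const, Measure.restrict_apply MeasurableSet.univ, univ_inter, Real.volume_Ioo]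
  rw [lintegral_mul_const _ hmeas]
  calc _ ≤ ENNReal.ofReal (2 * Real.log B) * ENNReal.ofReal (Real.pi - -Real.pi) := by
        gcongr; exact lintegral_Ioi_le hB
    _ = _ := by
      rw [← ENNReal.ofReal_mul (by have := Real.log_nonneg hB; positivity)]
      congr 1; ring

theorem two_log_sub_le_logRatio_sub {b : ℝ} (hb : 1 ≤ b) {u v : ℝ} (hu0 : 0 ≤ u) (hu : u ≤ 1)
    (hv : b ^ 2 ≤ v) :
    2 * Real.log b - 2 * Real.log 2 ≤
      (Real.log (1 + v) - Real.log (b ^ 2 + v)) - (Real.log (1 + u) - Real.log (b ^ 2 + u)) := by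
  have hv0 : 0 ≤ v := (sq_nonneg b).trans hv
  have hb2 : 0 < b ^ 2 := by positivity
  have h1 : Real.log (1 + v) - Real.log (b ^ 2 + v) ≥ - Real.log 2 := by
    rw [← Real.log_div (by positivity) (by positivity), ← Real.log_inv]
    refine Real.log_le_log (by norm_num) ?_
    rw [le_div_iff₀ (by positivity)]
    linarith
  have h2 : Real.log (1 + u) ≤ Real.log 2 := Real.log_le_log (by positivity) (by linarith)
  have h3 : 2 * Real.log b ≤ Real.log (b ^ 2 + u) := by
    rw [show 2 * Real.log b = Real.log (b ^ 2) by simp]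
    exact Real.log_le_log hb2 (by linarith)
  linarith

theorem sq_le_integral_vertical_segment {F : ℂ → ℂ} {U : Set ℂ} (hU : IsOpen U)
    (hF : DifferentiableOn ℂ F U) {b T x s t : ℝ} (hb : 2 ≤ b) (hT : 0 < T)
    (hx : ∀ y : ℝ, (⟨x, y⟩ : ℂ) ∈ U) (hs : s ∈ Icc 0 T) (ht : t ∈ Icc 0 T)
    (hFs : ‖F ⟨x, s⟩‖ ≤ 1) (hFt : b ≤ ‖F ⟨x, t⟩‖) :
    ENNReal.ofReal ((2 * Real.log b - 2 * Real.log 2) ^ 2 / T) ≤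
      ∫⁻ y in Ico 0 T, ENNReal.ofReal (‖deriv F ⟨x, y⟩‖ ^ 2) *
        ENNReal.ofReal (logRatioWeight (b ^ 2) (F ⟨x, y⟩)) := by
  have hB : 1 ≤ b ^ 2 := by nlinarith
  set q : ℝ → ℝ := fun y => ‖deriv F ⟨x, y⟩‖ ^ 2 * logRatioWeight (b ^ 2) (F ⟨x, y⟩) with hq
  have hline : ∀ y : ℝ, HasDerivAt (fun y : ℝ => (⟨x, y⟩ : ℂ)) Complex.I y := by
    intro y
    have h1 : HasDerivAt (fun y : ℝ => (x : ℂ) + (y : ℂ) * Complex.I) (1 * Complex.I) y :=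
      ((Complex.ofRealCLM.hasDerivAt (x := y)).mul_const Complex.I).const_add (x : ℂ)
    rw [one_mul] at h1
    refine h1.congr_of_eventuallyEq (Eventually.of_forall fun y => ?_)
    apply Complex.ext <;> simp
  have hlc : Continuous (fun y : ℝ => (⟨x, y⟩ : ℂ)) :=
    continuous_iff_continuousAt.2 fun y => (hline y).continuousAt
  have hFy : ∀ y : ℝ, HasDerivAt (fun y : ℝ => F ⟨x, y⟩) (deriv F ⟨x, y⟩ * Complex.I) y := fun y =>
    HasDerivAt.comp (h := fun y : ℝ => (⟨x, y⟩ : ℂ)) y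
      (hF.differentiableAt (hU.mem_nhds (hx y))).hasDerivAt (hline y)
  have hFc : Continuous (fun y : ℝ => F ⟨x, y⟩) :=
    continuous_iff_continuousAt.2 fun y => (hFy y).continuousAt
  have hDc : Continuous (fun y : ℝ => deriv F ⟨x, y⟩) :=
    (hF.deriv hU).continuousOn.comp_continuous hlc hx
  have hqc : Continuous q := (hDc.norm.pow 2).mul ((continuous_logRatioWeight hB).comp hFc)
  have hqnn : ∀ y, 0 ≤ q y := fun y => mul_nonneg (sq_nonneg _) (logRatioWeight_nonneg _ _)
  set v : ℝ → ℝ := fun y =>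
    Real.log (1 + ‖F ⟨x, y⟩‖ ^ 2) - Real.log (b ^ 2 + ‖F ⟨x, y⟩‖ ^ 2) with hv
  have hvd : ∀ y, HasDerivAt v (logRatioDeriv (b ^ 2) (‖F ⟨x, y⟩‖ ^ 2) *
      (2 * inner ℝ (F ⟨x, y⟩) (deriv F ⟨x, y⟩ * Complex.I))) y := fun y =>
    HasDerivAt.comp (h := fun y : ℝ => ‖F ⟨x, y⟩‖ ^ 2) y
      (hasDerivAt_logRatio hB (sq_nonneg _)) (hFy y).norm_sq
  have hvq : ∀ y, (logRatioDeriv (b ^ 2) (‖F ⟨x, y⟩‖ ^ 2) *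
      (2 * inner ℝ (F ⟨x, y⟩) (deriv F ⟨x, y⟩ * Complex.I))) ^ 2 ≤ q y := by
    intro y
    have h1 := abs_real_inner_le_norm (F ⟨x, y⟩) (deriv F ⟨x, y⟩ * Complex.I)
    rw [norm_mul, Complex.norm_I, mul_one] at h1
    have h2 : (inner ℝ (F ⟨x, y⟩) (deriv F ⟨x, y⟩ * Complex.I)) ^ 2 ≤
        (‖F ⟨x, y⟩‖ * ‖deriv F ⟨x, y⟩‖) ^ 2 := by
      rw [← sq_abs]; gcongr
    simp only [hq, logRatioWeight]
    calc _ = logRatioDeriv (b ^ 2) (‖F ⟨x, y⟩‖ ^ 2) ^ 2 * 4 *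
          (inner ℝ (F ⟨x, y⟩) (deriv F ⟨x, y⟩ * Complex.I)) ^ 2 := by ring
      _ ≤ logRatioDeriv (b ^ 2) (‖F ⟨x, y⟩‖ ^ 2) ^ 2 * 4 *
          (‖F ⟨x, y⟩‖ * ‖deriv F ⟨x, y⟩‖) ^ 2 := by gcongr
      _ = _ := by ring
  have hmain := sub_sq_le_mul_integral hT hvd hqc hvq hs ht
  have hosc : 2 * Real.log b - 2 * Real.log 2 ≤ v t - v s :=
    two_log_sub_le_logRatio_sub (by linarith) (sq_nonneg _) (by nlinarith [norm_nonneg (F ⟨x, s⟩)])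
      (by gcongr)
  have hlog : Real.log 2 ≤ Real.log b := Real.log_le_log (by norm_num) hb
  have hreal : (2 * Real.log b - 2 * Real.log 2) ^ 2 / T ≤ ∫ y in (0 : ℝ)..T, q y := by
    rw [div_le_iff₀' hT]
    exact le_trans (by gcongr; linarith) hmain
  refine (ENNReal.ofReal_le_ofReal hreal).trans (le_of_eq ?_)
  rw [intervalIntegral.integral_of_le hT.le, ← integral_Ico_eq_integral_Ioc,
    ofReal_integral_eq_lintegral_ofReal]
  · exact lintegral_congr fun y => ENNReal.ofReal_mul (sq_nonneg _)
  · exact (hqc.integrableOn_Icc (a := 0) (b := T)).mono_set Ico_subset_Icc_self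
  · exact ae_of_all _ hqnn

/-- A length-area estimate: if a `p`-valent function on a rectangle oscillates between modulus at
most `1` and modulus at least `b` on every vertical segment, then `log b` is at most of order
`p`. -/
theorem sq_log_le_of_oscillation {F : ℂ → ℂ} {U : Set ℂ} (hU : IsOpen U)
    (hF : DifferentiableOn ℂ F U) {b T : ℝ} (hb : 2 ≤ b) (hT : 0 < T) (p : ℕ)
    (hstrip : ∀ x ∈ Ioo (-2 : ℝ) (-1), ∀ y : ℝ, (⟨x, y⟩ : ℂ) ∈ U)
    (hp : ∀ (c : ℂ) (s : Finset ℂ),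
      (∀ z ∈ s, z ∈ Ioo (-2 : ℝ) (-1) ×ℂ Ico 0 T ∧ F z = c) → s.card ≤ p)
    (hosc : ∀ x ∈ Ioo (-2 : ℝ) (-1), ∃ s ∈ Icc 0 T, ∃ t ∈ Icc 0 T,
      ‖F ⟨x, s⟩‖ ≤ 1 ∧ b ≤ ‖F ⟨x, t⟩‖) :
    (2 * Real.log b - 2 * Real.log 2) ^ 2 ≤ T * (p * (8 * Real.pi * Real.log b)) := by
  have hB : 1 ≤ b ^ 2 := by nlinarith
  set A : Set ℂ := Ioo (-2 : ℝ) (-1) ×ℂ Ico 0 T with hA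
  have hAm : MeasurableSet A := 
    (Complex.measurable_re measurableSet_Ioo).inter (Complex.measurable_im measurableSet_Ico)
  have hAU : A ⊆ U := fun z hz => hstrip z.re hz.1 z.im
  set W : ℂ → ENNReal := fun w => ENNReal.ofReal (logRatioWeight (b ^ 2) w) with hW
  have hWm : Measurable W := (continuous_logRatioWeight hB).measurable.ennreal_ofReal
  set G : ℂ → ENNReal := fun z => ENNReal.ofReal (‖deriv F z‖ ^ 2) * W (F z) with hG
  have hup : ∫⁻ z in A, G z ≤ p * ∫⁻ w, W w :=
    lintegral_norm_deriv_sq_mul_comp_le hU hF hAU hAm p hp hWm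
  have hup2 : ∫⁻ z in A, G z ≤ ENNReal.ofReal (p * (8 * Real.pi * Real.log b)) := by
    refine hup.trans ?_
    rw [ENNReal.ofReal_mul (by positivity), ENNReal.ofReal_natCast]
    gcongr
    refine (lintegral_logRatioWeight_le hB).trans (le_of_eq ?_)
    rw [Real.log_pow]
    congr 1
    push_cast
    ring
  have hGm : AEMeasurable (fun q : ℝ × ℝ => G ⟨q.1, q.2⟩)
      ((volume.restrict (Ioo (-2 : ℝ) (-1))).prod (volume.restrict (Ico 0 T))) := by
    have h1 : ContinuousOn (fun q : ℝ × ℝ => G ⟨q.1, q.2⟩) (Ioo (-2 : ℝ) (-1) ×ˢ Ico 0 T) := by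
      have hl : Continuous (fun q : ℝ × ℝ => (⟨q.1, q.2⟩ : ℂ)) :=
        Complex.equivRealProdCLM.symm.continuous
      have hm : MapsTo (fun q : ℝ × ℝ => (⟨q.1, q.2⟩ : ℂ)) (Ioo (-2 : ℝ) (-1) ×ˢ Ico 0 T) U :=
        fun q hq => hstrip q.1 hq.1 q.2
      have hFc := hF.continuousOn.comp hl.continuousOn hm
      have hDc := (hF.deriv hU).continuousOn.comp hl.continuousOn hm
      have : ContinuousOn (fun q : ℝ × ℝ => ENNReal.ofReal (‖deriv F ⟨q.1, q.2⟩‖ ^ 2 *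
          logRatioWeight (b ^ 2) (F ⟨q.1, q.2⟩))) (Ioo (-2 : ℝ) (-1) ×ˢ Ico 0 T) :=
        ENNReal.continuous_ofReal.comp_continuousOn
          ((hDc.norm.pow 2).mul ((continuous_logRatioWeight hB).comp_continuousOn hFc))
      exact this.congr fun q _ => (ENNReal.ofReal_mul (sq_nonneg _)).symm
    rw [Measure.prod_restrict]
    exact h1.aemeasurable (measurableSet_Ioo.prod measurableSet_Ico)
  have hfub : ∫⁻ z in A, G z = ∫⁻ x in Ioo (-2 : ℝ) (-1), ∫⁻ y in Ico 0 T, G ⟨x, y⟩ := by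
    rw [← lintegral_prod _ hGm, Measure.prod_restrict, ← Measure.volume_eq_prod]
    exact (Complex.volume_preserving_equiv_real_prod.symm.setLIntegral_comp_preimage_emb
      Complex.measurableEquivRealProd.symm.measurableEmbedding G A).symm
  have hlow : ENNReal.ofReal ((2 * Real.log b - 2 * Real.log 2) ^ 2 / T) ≤ ∫⁻ z in A, G z := by
    rw [hfub]
    calc ENNReal.ofReal ((2 * Real.log b - 2 * Real.log 2) ^ 2 / T)
        = ∫⁻ x in Ioo (-2 : ℝ) (-1), ENNReal.ofReal ((2 * Real.log b - 2 * Real.log 2) ^ 2 / T) := by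
          simp; norm_num
      _ ≤ _ := setLIntegral_mono' measurableSet_Ioo fun x hx => by
          obtain ⟨s, hs, t, ht, h1, h2⟩ := hosc x hx
          exact sq_le_integral_vertical_segment hU hF hb hT (hstrip x hx) hs ht h1 h2
  have hlogb : 0 ≤ Real.log b := Real.log_nonneg (by linarith)
  have := (ENNReal.ofReal_le_ofReal_iff (by positivity)).1 (hlow.trans hup2)
  rwa [div_le_iff₀' hT] at this

theorem exists_mem_Icc_eq_exp {z : ℂ} {x : ℝ} (hz : ‖z‖ = Real.exp x) :
    ∃ s ∈ Icc 0 (2 * Real.pi), Complex.exp ⟨x, s⟩ = z := by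
  have hexp : Complex.exp ⟨x, z.arg⟩ = z := by
    conv_rhs => rw [← Complex.norm_mul_exp_arg_mul_I z, hz, Complex.ofReal_exp, ← Complex.exp_add]
    congr 1
    apply Complex.ext <;> simp
  have h1 := Complex.neg_pi_lt_arg z
  have h2 := Complex.arg_le_pi z
  have hpi := Real.pi_pos
  rcases le_or_gt 0 z.arg with h | h
  · exact ⟨z.arg, ⟨h, by linarith⟩, hexp⟩
  · refine ⟨z.arg + 2 * Real.pi, ⟨by linarith, by linarith⟩, ?_⟩
    have h3 := Complex.exp_periodic ⟨x, z.arg⟩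
    rw [hexp] at h3
    refine Eq.trans ?_ h3
    congr 1
    apply Complex.ext <;> simp

theorem injOn_exp_reProdIm (s : Set ℝ) :
    InjOn Complex.exp (s ×ℂ Ico 0 (2 * Real.pi)) := by
  intro z hz w hw h
  obtain ⟨n, hn⟩ := Complex.exp_eq_exp_iff_exists_int.1 h
  have him : z.im = w.im + n * (2 * Real.pi) := by
    have := congrArg Complex.im hn
    simpa using this
  have hz2 := hz.2
  have hw2 := hw.2
  simp only [mem_preimage, mem_Ico] at hz2 hw2
  have hpi := Real.pi_pos
  have h1 : (n : ℝ) < 1 := by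
    by_contra hc
    push Not at hc
    nlinarith
  have h2 : (-1 : ℝ) < n := by
    by_contra hc
    push Not at hc
    nlinarith
  have h3 : n < 1 := by exact_mod_cast h1
  have h4 : -1 < n := by exact_mod_cast h2
  have : n = 0 := by omega
  simpa [this] using hn

theorem exists_circle_large_or_small {f : ℂ → ℂ} (hf : DifferentiableOn ℂ f (Metric.ball 0 1))
    {p : ℕ} (hp1 : 1 ≤ p)
    (hp : ∀ (c : ℂ) (s : Finset ℂ), (∀ z ∈ s, ‖z‖ < 1 ∧ f z = c) → s.card ≤ p)
    {a : ℝ} (ha : 0 < a) :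
    ∃ r, Real.exp (-2) < r ∧ r < Real.exp (-1) ∧
      ((∀ z : ℂ, ‖z‖ = r → a < ‖f z‖) ∨ ∀ z : ℂ, ‖z‖ = r → ‖f z‖ < a * Real.exp (200 * p)) := by
  by_contra! hcon
  set U : Set ℂ := {z | z.re < 0} with hUdef
  have hU : IsOpen U := isOpen_lt Complex.continuous_re continuous_const
  set F : ℂ → ℂ := fun z => f (Complex.exp z) / a with hFdef
  have hF : DifferentiableOn ℂ F U := by
    refine DifferentiableOn.div_const (hf.comp Complex.differentiable_exp.differentiableOn ?_) _
    intro z hz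
    simpa [Complex.norm_exp, hUdef] using hz
  have hp1' : (1 : ℝ) ≤ p := by exact_mod_cast hp1
  have hb : 2 ≤ Real.exp (200 * p) := by
    have := Real.add_one_le_exp (200 * (p : ℝ)); linarith
  have hmain := sq_log_le_of_oscillation hU hF hb Real.two_pi_pos p
    (fun x hx y => by simp only [hUdef, mem_ofPred_eq]; linarith [hx.2])
    (by
      classical
      intro c s hs
      rw [← Finset.card_image_of_injOn
        ((injOn_exp_reProdIm (Ioo (-2) (-1))).mono fun z hz => (hs z hz).1)]
      refine hp (c * a) _ fun w hw => ?_
      obtain ⟨z, hz, rfl⟩ := Finset.mem_image.1 hw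
      refine ⟨?_, ?_⟩
      · rw [Complex.norm_exp, Real.exp_lt_one_iff]
        linarith [(hs z hz).1.1.2]
      · rw [← (hs z hz).2]
        have : (a : ℂ) ≠ 0 := by exact_mod_cast ha.ne'
        simp only [hFdef]
        field_simp)
    (by
      intro x hx
      obtain ⟨⟨z, hz, hza⟩, w, hw, hwa⟩ := hcon (Real.exp x) (Real.exp_lt_exp.2 hx.1)
        (Real.exp_lt_exp.2 hx.2)
      obtain ⟨s, hs, rfl⟩ := exists_mem_Icc_eq_exp hz
      obtain ⟨t, ht, rfl⟩ := exists_mem_Icc_eq_exp hw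
      refine ⟨s, hs, t, ht, ?_, ?_⟩
      · rw [norm_div, Complex.norm_of_nonneg ha.le, div_le_one ha]
        exact hza
      · rw [norm_div, Complex.norm_of_nonneg ha.le, le_div_iff₀ ha, mul_comm]
        exact hwa)
  rw [Real.log_exp] at hmain
  have hpi : Real.pi ^ 2 ≤ 10 := by nlinarith [Real.pi_lt_d2, Real.pi_pos]
  have hlog2 := Real.log_two_lt_d9
  have h1 : (398 * (p : ℝ)) ^ 2 ≤ (2 * (200 * (p : ℝ)) - 2 * Real.log 2) ^ 2 := by
    gcongr
    linarith
  have h2 : 2 * Real.pi * (p * (8 * Real.pi * (200 * (p : ℝ)))) = 3200 * p ^ 2 * Real.pi ^ 2 := by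
    ring
  rw [h2] at hmain
  have h3 : 3200 * (p : ℝ) ^ 2 * Real.pi ^ 2 ≤ 3200 * (p : ℝ) ^ 2 * 10 := by gcongr
  nlinarith

theorem hasSum_update_sub {a : ℕ → ℂ} {z s : ℂ} (h : HasSum (fun k : ℕ => a k * z ^ k) s) (c : ℂ) :
    HasSum (fun k : ℕ => Function.update a 0 (a 0 - c) k * z ^ k) (s - c) := by
  have h1 := h.sub (hasSum_ite_eq (0 : ℕ) c)
  refine h1.congr_fun ?_
  intro k
  rcases eq_or_ne k 0 with rfl | hk
  · simp
  · simp [hk]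

/-- A function with small initial coefficients which takes every value at most `p` times cannot be
large on a whole circle. -/
theorem le_of_forall_sphere_le_norm {a : ℕ → ℂ} {f : ℂ → ℂ} {p : ℕ} {ε A r : ℝ}
    (h : ∀ z ∈ Metric.ball (0 : ℂ) 1, HasSum (fun k : ℕ => a k * z ^ k) (f z))
    (hp : ∀ (c : ℂ) (s : Finset ℂ), (∀ z ∈ s, ‖z‖ < 1 ∧ f z = c) → s.card ≤ p)
    (hε : 0 < ε) (hA : 0 < A) (ha0 : a 0 = 0) (ha : ∀ i, 1 ≤ i → i ≤ p → ‖a i‖ ≤ ε)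
    (hr : Real.exp (-2) < r) (hr2 : r ≤ 1 / 2) (hfA : ∀ z : ℂ, ‖z‖ = r → A ≤ ‖f z‖) :
    A ≤ 2 * ε * ((p + 1) * Real.exp (2 * p)) := by
  classical
  have hr0 : 0 < r := (Real.exp_pos _).trans hr
  have hfd : DifferentiableOn ℂ f (Metric.ball 0 1) := differentiableOn_of_hasSum one_pos h
  set δ := min ε (A / 2) with hδ
  have hδ0 : 0 < δ := lt_min hε (by positivity)
  obtain ⟨w, hwδ, hwcrit⟩ : ∃ w ∈ Metric.ball (0 : ℂ) δ,
      w ∉ f '' (Metric.ball 0 1 ∩ {z | deriv f z = 0}) := by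
    by_contra! hcon
    have hz : volume (f '' (Metric.ball 0 1 ∩ {z | deriv f z = 0})) = 0 := by
      refine addHaar_image_eq_zero_of_det_fderivWithin_eq_zero volume (f' := fun x =>
        ((ContinuousLinearMap.toSpanSingleton ℂ (deriv f x)).restrictScalars ℝ : ℂ →L[ℝ] ℂ))
        ?_ ?_
      · intro x hx
        have hd := (hfd.differentiableAt (Metric.isOpen_ball.mem_nhds hx.1)).hasDerivAt
        exact (hd.hasFDerivAt.restrictScalars ℝ).hasFDerivWithinAt
      · intro x hx
        rw [← abs_eq_zero, abs_det_restrictScalars_smulRight, show deriv f x = 0 from hx.2]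
        simp
    exact (Metric.measure_ball_pos volume (0 : ℂ) hδ0).ne' (measure_mono_null hcon hz)
  have hwn : ‖w‖ < δ := by simpa using hwδ
  set g : ℂ → ℂ := fun z => f z - w with hg
  have hgs : ∀ z ∈ Metric.ball (0 : ℂ) 1,
      HasSum (fun k : ℕ => Function.update a 0 (a 0 - w) k * z ^ k) (g z) :=
    fun z hz => hasSum_update_sub (h z hz) w
  have hgd : DifferentiableOn ℂ g (Metric.ball 0 1) := hfd.sub_const w
  have hgA : ∀ z : ℂ, ‖z‖ = r → A / 2 ≤ ‖g z‖ := by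
    intro z hz
    have h1 := norm_sub_norm_le (f z) w
    have h2 := hfA z hz
    have h3 := min_le_right ε (A / 2)
    simp only [hg]; linarith
  have hSfin : {z : ℂ | ‖z‖ < r ∧ g z = 0}.Finite := by
    by_contra hinf
    obtain ⟨t, ht, htc⟩ := Set.Infinite.exists_subset_card_eq hinf (p + 1)
    have := hp w t fun z hz => ⟨(ht hz).1.trans (by linarith), sub_eq_zero.1 (ht hz).2⟩
    omega
  set S := hSfin.toFinset with hS
  have hSmem : ∀ z, z ∈ S ↔ ‖z‖ < r ∧ g z = 0 := fun z => by simp [hS]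
  have hSp : S.card ≤ p := hp w S fun z hz =>
    ⟨((hSmem z).1 hz).1.trans (by linarith), sub_eq_zero.1 ((hSmem z).1 hz).2⟩
  obtain ⟨k, hkd, hgk⟩ := exists_eq_prod_sub_mul Metric.isOpen_ball S hgd
    (fun s hs => ⟨by simpa using ((hSmem s).1 hs).1.trans (by linarith : r < 1), ((hSmem s).1 hs).2⟩)
  set Q : ℂ → ℂ := fun z => ∏ s ∈ S, (z - s) with hQ
  have hQd : Differentiable ℂ Q := by
    simp only [hQ]; fun_prop
  have hk0 : ∀ z : ℂ, ‖z‖ ≤ r → k z ≠ 0 := by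
    intro z hz hkz
    have hgz : g z = 0 := by rw [hgk, hkz, mul_zero]
    rcases hz.lt_or_eq with hlt | heq
    · have hz1 : z ∈ Metric.ball (0 : ℂ) 1 := by simpa using hlt.trans (by linarith)
      have hzS : z ∈ S := (hSmem z).2 ⟨hlt, hgz⟩
      have hQz : Q z = 0 := Finset.prod_eq_zero hzS (sub_self z)
      have hkz' := (hkd.differentiableAt (Metric.isOpen_ball.mem_nhds hz1)).hasDerivAt
      have hder := (hQd z).hasDerivAt.mul hkz'
      rw [hQz, hkz, mul_zero, zero_mul, add_zero] at hder
      have hfz : HasDerivAt f 0 z := by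
        have h1 : f = fun z => (Q * k) z + w := by
          ext y
          have := hgk y
          simp only [hg] at this
          simp only [Pi.mul_apply, hQ, ← this]
          ring
        rw [h1]
        exact hder.add_const w
      exact hwcrit ⟨z, ⟨hz1, hfz.deriv⟩, sub_eq_zero.1 hgz⟩
    · have := hgA z heq
      rw [hgz, norm_zero] at this
      linarith
  have hkid : DifferentiableOn ℂ (fun z => (k z)⁻¹) (Metric.closedBall 0 r) :=
    (hkd.mono (Metric.closedBall_subset_ball (by linarith))).inv fun z hz => hk0 z (by simpa using hz)
  have hki : DiffContOnCl ℂ (fun z => (k z)⁻¹) (Metric.ball 0 r) :=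
    hkid.diffContOnCl_ball subset_rfl
  have hkA : ∀ z ∈ Metric.sphere (0 : ℂ) r, ‖(k z)⁻¹‖ ≤ 2 / A := by
    intro z hz
    have hz' : ‖z‖ = r := by simpa using hz
    have hQ1 : ‖Q z‖ ≤ 1 := by
      simp only [hQ, norm_prod]
      refine Finset.prod_le_one (fun _ _ => norm_nonneg _) fun s hs => ?_
      have := norm_sub_le z s
      have := ((hSmem s).1 hs).1
      linarith
    have h1 : A / 2 ≤ ‖k z‖ := by
      calc A / 2 ≤ ‖g z‖ := hgA z hz'
        _ = ‖Q z‖ * ‖k z‖ := by rw [hgk, norm_mul]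
        _ ≤ 1 * ‖k z‖ := by gcongr
        _ = _ := one_mul _
    rw [norm_inv, show 2 / A = (A / 2)⁻¹ by field_simp]
    gcongr
  set n := S.card with hn
  have hQg : Q =ᶠ[𝓝 0] g * fun z => (k z)⁻¹ := by
    filter_upwards [Metric.ball_mem_nhds (0 : ℂ) hr0] with z hz
    have := hk0 z (by simpa using le_of_lt (by simpa using hz : ‖z‖ < r))
    simp only [Pi.mul_apply, hgk z, hQ]
    field_simp
  have hg_an : ContDiffAt ℂ n g 0 :=
    (hgd.analyticAt (Metric.ball_mem_nhds 0 one_pos)).contDiffAt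
  have hk_an : ContDiffAt ℂ n (fun z => (k z)⁻¹) 0 :=
    (hkid.analyticAt (Metric.closedBall_mem_nhds 0 hr0)).contDiffAt
  have hleib := iteratedDeriv_mul hg_an hk_an
  rw [← hQg.iteratedDeriv_eq n, iteratedDeriv_card_prod_sub] at hleib
  have hcoef : ∀ i ≤ n, ‖Function.update a 0 (a 0 - w) i‖ ≤ ε := by
    intro i hi
    rcases Nat.eq_zero_or_pos i with rfl | hi0
    · rw [Function.update_self, ha0, zero_sub, norm_neg]
      exact hwn.le.trans (min_le_left _ _)
    · rw [Function.update_of_ne hi0.ne']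
      exact ha i hi0 (hi.trans hSp)
  have hterm : ∀ i ∈ Finset.range (n + 1),
      ‖(n.choose i : ℂ) * iteratedDeriv i g 0 * iteratedDeriv (n - i) (fun z => (k z)⁻¹) 0‖ ≤
        n.factorial * (ε * (2 / A * Real.exp (2 * p))) := by
    intro i hi
    have hin : i ≤ n := Nat.lt_succ_iff.1 (Finset.mem_range.1 hi)
    have h1 := Complex.norm_iteratedDeriv_le_of_forall_mem_sphere_norm_le (n - i) hr0 hki hkA
    have hrp : (r ^ (n - i))⁻¹ ≤ Real.exp (2 * p) := by
      have h2 : Real.exp (-2) ^ (n - i) ≤ r ^ (n - i) := by gcongr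
      rw [← Real.exp_nat_mul] at h2
      refine inv_le_of_inv_le₀ (Real.exp_pos _) (le_trans ?_ h2)
      rw [← Real.exp_neg, Real.exp_le_exp]
      have : ((n - i : ℕ) : ℝ) ≤ p := by exact_mod_cast (Nat.sub_le n i).trans hSp
      linarith
    rw [norm_mul, norm_mul, iteratedDeriv_zero_of_hasSum one_pos hgs, norm_mul,
      Complex.norm_natCast, Complex.norm_natCast]
    have hch : (n.choose i : ℝ) * i.factorial * (n - i).factorial = n.factorial := by
      exact_mod_cast Nat.choose_mul_factorial_mul_factorial hin
    calc (n.choose i : ℝ) * (i.factorial * ‖Function.update a 0 (a 0 - w) i‖) *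
          ‖iteratedDeriv (n - i) (fun z => (k z)⁻¹) 0‖
        ≤ (n.choose i : ℝ) * (i.factorial * ε) * ((n - i).factorial * (2 / A) / r ^ (n - i)) := by
          gcongr
          exact hcoef i hin
      _ = (n.choose i : ℝ) * i.factorial * (n - i).factorial * (ε * (2 / A * (r ^ (n - i))⁻¹)) := by
          ring
      _ ≤ _ := by
          rw [hch]; gcongr
  have hsum : (n.factorial : ℝ) ≤ (n + 1) * (n.factorial * (ε * (2 / A * Real.exp (2 * p)))) := by
    calc (n.factorial : ℝ) = ‖(n.factorial : ℂ)‖ := (Complex.norm_natCast _).symm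
      _ ≤ _ := by
        rw [hleib]
        refine (norm_sum_le_of_le _ hterm).trans (le_of_eq ?_)
        simp
  have hfac : (0 : ℝ) < n.factorial := by positivity
  have h1 : 1 ≤ (n + 1) * (ε * (2 / A * Real.exp (2 * p))) := by
    refine le_of_mul_le_mul_left ?_ hfac
    linarith
  have hnp : (n : ℝ) ≤ p := by exact_mod_cast hSp
  have h2 : A ≤ (n + 1) * (ε * (2 * Real.exp (2 * p))) := by
    calc A = A * 1 := (mul_one A).symm
      _ ≤ A * ((n + 1) * (ε * (2 / A * Real.exp (2 * p)))) := by gcongr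
      _ = _ := by field_simp
  calc A ≤ (n + 1) * (ε * (2 * Real.exp (2 * p))) := h2
    _ ≤ (p + 1) * (ε * (2 * Real.exp (2 * p))) := by gcongr
    _ = _ := by ring

/-- Taylor domination for `p`-valent functions. -/
theorem norm_coeff_le_of_pvalent {a : ℕ → ℂ} {f : ℂ → ℂ} {p : ℕ} (hp1 : 1 ≤ p) {ε : ℝ}
    (h : ∀ z ∈ Metric.ball (0 : ℂ) 1, HasSum (fun k : ℕ => a k * z ^ k) (f z))
    (hp : ∀ (c : ℂ) (s : Finset ℂ), (∀ z ∈ s, ‖z‖ < 1 ∧ f z = c) → s.card ≤ p)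
    (hε : 0 < ε) (ha : ∀ i, 1 ≤ i → i ≤ p → ‖a i‖ ≤ ε) {n : ℕ} (hn : 1 ≤ n) :
    ‖a n‖ ≤ ε * Real.exp (205 * p) * Real.exp 2 ^ n := by
  set g : ℂ → ℂ := fun z => f z - a 0 with hg
  have hgs : ∀ z ∈ Metric.ball (0 : ℂ) 1,
      HasSum (fun k : ℕ => Function.update a 0 (a 0 - a 0) k * z ^ k) (g z) :=
    fun z hz => hasSum_update_sub (h z hz) (a 0)
  have hpg : ∀ (c : ℂ) (s : Finset ℂ), (∀ z ∈ s, ‖z‖ < 1 ∧ g z = c) → s.card ≤ p :=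
    fun c s hs => hp (c + a 0) s fun z hz => ⟨(hs z hz).1, sub_eq_iff_eq_add.1 (hs z hz).2⟩
  have hp1' : (1 : ℝ) ≤ p := by exact_mod_cast hp1
  set A := 2 * ε * Real.exp (4 * p) with hA
  have hA0 : 0 < A := by positivity
  obtain ⟨r, hr1, hr2, hor⟩ :=
    exists_circle_large_or_small (differentiableOn_of_hasSum one_pos hgs) hp1 hpg hA0
  have hr0 : 0 < r := (Real.exp_pos _).trans hr1
  have hrhalf : r ≤ 1 / 2 := by
    refine hr2.le.trans ?_
    rw [Real.exp_neg, one_div]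
    gcongr
    have := Real.add_one_le_exp (1 : ℝ)
    linarith
  rcases hor with hlarge | hsmall
  · exfalso
    have h1 := le_of_forall_sphere_le_norm hgs hpg hε hA0 (by simp)
      (fun i hi hip => by rw [Function.update_of_ne (by omega)]; exact ha i hi hip) hr1 hrhalf
      (fun z hz => (hlarge z hz).le)
    rw [hA] at h1
    have h2 : Real.exp (4 * p) ≤ (p + 1) * Real.exp (2 * p) :=
      le_of_mul_le_mul_left h1 (by positivity)
    have h3 : (p : ℝ) + 1 < Real.exp (2 * p) := by
      have := Real.add_one_le_exp (2 * (p : ℝ)); linarith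
    have h4 : Real.exp (4 * (p : ℝ)) = Real.exp (2 * p) * Real.exp (2 * p) := by
      rw [← Real.exp_add]; ring_nf
    rw [h4] at h2
    exact absurd (le_of_mul_le_mul_right h2 (Real.exp_pos _)) (not_le.2 h3)
  · have h1 := norm_coeff_le_of_hasSum hr0 (by linarith) hgs (fun z hz => (hsmall z hz).le) n
    rw [Function.update_of_ne (by omega)] at h1
    refine h1.trans ?_
    rw [div_eq_mul_inv, ← inv_pow]
    have hri : r⁻¹ ≤ Real.exp 2 := by
      refine inv_le_of_inv_le₀ (Real.exp_pos _) ?_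
      rw [← Real.exp_neg]
      exact hr1.le
    have h2 : A * Real.exp (200 * p) ≤ ε * Real.exp (205 * p) := by
      have h3 : 2 ≤ Real.exp (p : ℝ) := by
        have := Real.add_one_le_exp (p : ℝ); linarith
      have h5 : Real.exp (205 * (p : ℝ)) =
          Real.exp p * (Real.exp (4 * p) * Real.exp (200 * p)) := by
        rw [← Real.exp_add, ← Real.exp_add]; ring_nf
      rw [h5, hA]
      calc 2 * ε * Real.exp (4 * p) * Real.exp (200 * p)
          = ε * (2 * (Real.exp (4 * p) * Real.exp (200 * p))) := by ring
        _ ≤ _ := by gcongr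
    gcongr

/-- An entire function with many zeros in a disk grows accordingly. -/
theorem two_pow_card_mul_norm_le {G : ℂ → ℂ} (hG : Differentiable ℂ G) {R X : ℝ} (hR : 0 < R)
    (hX : ∀ z : ℂ, ‖z‖ = 5 * R → ‖G z‖ ≤ X) (S : Finset ℂ) (hS : ∀ s ∈ S, ‖s‖ < R ∧ G s = 0)
    {z : ℂ} (hz : ‖z‖ ≤ R) : 2 ^ S.card * ‖G z‖ ≤ X := by
  obtain ⟨h, hh, hGh⟩ := exists_eq_prod_sub_mul isOpen_univ S hG.differentiableOn
    (fun s hs => ⟨mem_univ s, (hS s hs).2⟩)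
  have hh' : Differentiable ℂ h := differentiableOn_univ.1 hh
  have hbd : ∀ w ∈ frontier (Metric.ball (0 : ℂ) (5 * R)), ‖h w‖ ≤ X / (4 * R) ^ S.card := by
    intro w hw
    rw [frontier_ball (0 : ℂ) (by positivity)] at hw
    have hw' : ‖w‖ = 5 * R := by simpa using hw
    rw [le_div_iff₀ (by positivity)]
    refine le_trans ?_ (hX w hw')
    rw [hGh, norm_mul, mul_comm, norm_prod]
    gcongr
    rw [← Finset.prod_const]
    refine Finset.prod_le_prod (fun _ _ => by positivity) fun s hs => ?_
    have h1 := norm_sub_norm_le w s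
    have h2 := (hS s hs).1
    linarith
  have hz5 : z ∈ closure (Metric.ball (0 : ℂ) (5 * R)) := by
    refine subset_closure ?_
    simpa using (by linarith : ‖z‖ < 5 * R)
  have hhz := Complex.norm_le_of_forall_mem_frontier_norm_le Metric.isBounded_ball
    (hh'.diffContOnCl (s := Metric.ball (0 : ℂ) (5 * R))) hbd hz5
  have hprod : ∏ s ∈ S, ‖z - s‖ ≤ (2 * R) ^ S.card := by
    rw [← Finset.prod_const]
    refine Finset.prod_le_prod (fun _ _ => norm_nonneg _) fun s hs => ?_
    have h1 := norm_sub_le z s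
    have h2 := (hS s hs).1
    linarith
  rw [hGh, norm_mul, norm_prod]
  calc 2 ^ S.card * ((∏ s ∈ S, ‖z - s‖) * ‖h z‖)
      ≤ 2 ^ S.card * ((2 * R) ^ S.card * (X / (4 * R) ^ S.card)) := by gcongr
    _ = X := by
      rw [show 4 * R = 2 * (2 * R) by ring, mul_pow 2 (2 * R)]
      field_simp

/-- Zero count for the Borel transform of a `p`-valent function. -/
theorem card_le_of_borel_transform {a : ℕ → ℂ} {f Bf : ℂ → ℂ} {p : ℕ} (hp1 : 1 ≤ p)
    (h : ∀ z ∈ Metric.ball (0 : ℂ) 1, HasSum (fun k : ℕ => a k * z ^ k) (f z))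
    (hp : ∀ (c : ℂ) (s : Finset ℂ), (∀ z ∈ s, ‖z‖ < 1 ∧ f z = c) → s.card ≤ p)
    (hB : ∀ z : ℂ, HasSum (fun k : ℕ => a k / (Nat.factorial k : ℂ) * z ^ k) (Bf z))
    {R : ℝ} (hR : 1 < R) (c : ℂ) (S : Finset ℂ) (hS : ∀ z ∈ S, ‖z‖ < R ∧ Bf z = c) :
    (S.card : ℝ) ≤ 1000 * ((1 + Real.log p + Real.log R) * p + R) := by
  have hp1' : (1 : ℝ) ≤ p := by exact_mod_cast hp1
  have hR0 : 0 < R := by linarith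
  set b : ℕ → ℂ := Function.update (fun k => a k / (Nat.factorial k : ℂ)) 0
    (a 0 / (Nat.factorial 0 : ℂ) - c) with hb
  have hbk : ∀ k, 1 ≤ k → b k = a k / (Nat.factorial k : ℂ) := fun k hk => by
    rw [hb, Function.update_of_ne (by omega)]
  set G : ℂ → ℂ := fun z => Bf z - c with hG
  have hGs : ∀ z, HasSum (fun k : ℕ => b k * z ^ k) (G z) := fun z => hasSum_update_sub (hB z) c
  have hGd : Differentiable ℂ G := fun z =>
    (differentiableOn_of_hasSum (ρ := ‖z‖ + 1) (by positivity) fun w _ => hGs w).differentiableAt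
      (Metric.isOpen_ball.mem_nhds (by simp))
  obtain ⟨z₀, hz₀, hmax⟩ := (isCompact_closedBall (0 : ℂ) R).exists_isMaxOn
    (Metric.nonempty_closedBall.2 hR0.le) hGd.continuous.norm.continuousOn
  set X := ‖G z₀‖ with hX
  have hbX : ∀ k, ‖b k‖ ≤ X := by
    intro k
    have h1 := norm_coeff_le_of_hasSum (C := X) hR0 (lt_add_one R) (fun w _ => hGs w)
      (fun z hz => hmax (by simpa using hz.le)) k
    exact h1.trans (div_le_self (norm_nonneg _) (one_le_pow₀ hR.le))
  have hak : ∀ k, 1 ≤ k → ‖a k‖ ≤ k.factorial * X := by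
    intro k hk
    have h1 := hbX k
    rw [hbk k hk, norm_div, Complex.norm_natCast, div_le_iff₀ (by positivity)] at h1
    linarith
  have hXpos : 0 < X := by
    refine (norm_nonneg _).lt_of_ne' fun hX0 => ?_
    have ha0 : ∀ k, k ≠ 0 → a k = 0 := fun k hk => by
      have := hak k (by omega)
      rw [hX, hX0, mul_zero] at this
      exact norm_le_zero_iff.1 this
    have hconst : ∀ z : ℂ, ‖z‖ < 1 → f z = a 0 := by
      intro z hz
      have h1 : HasSum (fun k : ℕ => a k * z ^ k) (a 0 * z ^ 0) :=
        hasSum_single 0 fun k hk => by rw [ha0 k hk, zero_mul]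
      simpa using (h z (by simpa using hz)).unique h1
    have hinf : (Metric.ball (0 : ℂ) 1).Infinite :=
      infinite_of_mem_nhds 0 (Metric.ball_mem_nhds 0 one_pos)
    obtain ⟨t, ht, htc⟩ := hinf.exists_subset_card_eq (p + 1)
    have := hp (a 0) t fun z hz => by
      have hz1 : ‖z‖ < 1 := by simpa using ht hz
      exact ⟨hz1, hconst z hz1⟩
    omega
  set ε := (p : ℝ) ^ p * X with hε
  have hε0 : 0 < ε := by positivity
  have haε : ∀ i, 1 ≤ i → i ≤ p → ‖a i‖ ≤ ε := by
    intro i hi hip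
    refine (hak i hi).trans ?_
    rw [hε]
    gcongr
    have h1 : i.factorial ≤ p ^ p :=
      (Nat.factorial_le hip).trans (Nat.factorial_le_pow p)
    exact_mod_cast h1
  have hdom : ∀ n, 1 ≤ n → ‖a n‖ ≤ ε * Real.exp (205 * p) * Real.exp 2 ^ n :=
    fun n hn => norm_coeff_le_of_pvalent hp1 h hp hε0 haε hn
  set Y := ε * Real.exp (205 * p) with hY
  have hXY : X ≤ Y := by
    have h1 : 1 ≤ (p : ℝ) ^ p := one_le_pow₀ hp1'
    have h2 : 1 ≤ Real.exp (205 * (p : ℝ)) := Real.one_le_exp (by positivity)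
    rw [hY, hε]
    calc X = 1 * X * 1 := by ring
      _ ≤ _ := by gcongr
  set E := Real.exp 2 * (5 * R) with hE
  have hgrow : ∀ z : ℂ, ‖z‖ = 5 * R → ‖G z‖ ≤ Y * Real.exp E := by
    intro z hz
    have hexp : HasSum (fun k : ℕ => Y * (E ^ k / k.factorial)) (Y * Real.exp E) := by
      have := NormedSpace.expSeries_div_hasSum_exp (𝔸 := ℝ) E
      rw [← Real.exp_eq_exp_ℝ] at this
      exact this.mul_left Y
    rw [← (hGs z).tsum_eq]
    refine tsum_of_norm_bounded hexp fun k => ?_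
    rw [norm_mul, norm_pow, hz]
    rcases Nat.eq_zero_or_pos k with rfl | hk
    · simpa using (hbX 0).trans hXY
    · rw [hbk k hk, norm_div, Complex.norm_natCast]
      calc ‖a k‖ / k.factorial * (5 * R) ^ k
          ≤ (Y * Real.exp 2 ^ k) / k.factorial * (5 * R) ^ k := by
            gcongr; exact hdom k hk
        _ = _ := by rw [hE, mul_pow]; ring
  have hfin := two_pow_card_mul_norm_le hGd hR0 hgrow S
    (fun s hs => ⟨(hS s hs).1, sub_eq_zero.2 (hS s hs).2⟩) (z := z₀) (by simpa using hz₀)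
  have hpow : (2 : ℝ) ^ S.card ≤ (p : ℝ) ^ p * Real.exp (205 * p) * Real.exp E := by
    refine le_of_mul_le_mul_right ?_ hXpos
    refine hfin.trans (le_of_eq ?_)
    rw [hY, hε]; ring
  have hlog := Real.log_le_log (by positivity) hpow
  rw [Real.log_mul (by positivity) (by positivity), Real.log_mul (by positivity) (by positivity),
    Real.log_exp, Real.log_exp, Real.log_pow, Real.log_pow] at hlog
  have he2 : Real.exp 2 ≤ 9 := by
    have h1 : Real.exp 2 = Real.exp 1 * Real.exp 1 := by rw [← Real.exp_add]; norm_num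
    have h2 := Real.exp_one_lt_d9
    have h3 := Real.exp_pos 1
    rw [h1]; nlinarith
  have hE' : E ≤ 45 * R := by rw [hE]; nlinarith
  have hl2 := Real.log_two_gt_d9
  have hlp : 0 ≤ p * Real.log p := mul_nonneg (by positivity) (Real.log_nonneg hp1')
  have hlR : 0 ≤ p * Real.log R := mul_nonneg (by positivity) (Real.log_nonneg hR.le)
  have hcard : (S.card : ℝ) * (1 / 2) ≤ S.card * Real.log 2 := by gcongr; linarith
  nlinarith

/-- **Exponential Taylor domination (main theorem).**
There is an absolute constant `K > 0` such that if `f(z) = ∑ aₖ zᵏ` is analytic and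
`p`-valent in the unit disk, then for every `R > 1` and `0 < R' < R` the Borel
transform `B(f)(z) = ∑ (aₖ/k!) zᵏ` is `q`-valent in the disk of radius `R'`, where
`q = ⌈K·((1 + log p + log R)·p + R)⌉`. -/
theorem exponential_taylor_domination :
    ∃ K : ℝ, 0 < K ∧
      ∀ (p : ℕ), 1 ≤ p →
      ∀ (a : ℕ → ℂ) (f Bf : ℂ → ℂ),
        (∀ z ∈ Metric.ball (0 : ℂ) 1, HasSum (fun k : ℕ => a k * z ^ k) (f z)) →
        (∀ c : ℂ, {z : ℂ | ‖z‖ < 1 ∧ f z = c}.Finite ∧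
          {z : ℂ | ‖z‖ < 1 ∧ f z = c}.ncard ≤ p) →
        (∀ z : ℂ, HasSum (fun k : ℕ => a k / (Nat.factorial k : ℂ) * z ^ k) (Bf z)) →
        ∀ R R' : ℝ, 1 < R → 0 < R' → R' < R →
        ∀ c : ℂ,
          {z : ℂ | ‖z‖ < R' ∧ Bf z = c}.Finite ∧
          ({z : ℂ | ‖z‖ < R' ∧ Bf z = c}.ncard : ℤ) ≤
            ⌈K * ((1 + Real.log p + Real.log R) * p + R)⌉ := by
  refine ⟨1000, by norm_num, fun p hp1 a f Bf hf hval hB R R' hR _ hR'R c => ?_⟩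
  have hp : ∀ (c : ℂ) (s : Finset ℂ), (∀ z ∈ s, ‖z‖ < 1 ∧ f z = c) → s.card ≤ p := by
    intro c s hs
    rw [← Set.ncard_coe_finset]
    exact (Set.ncard_le_ncard (fun z hz => hs z hz) (hval c).1).trans (hval c).2
  have hcard : ∀ S : Finset ℂ, (∀ z ∈ S, ‖z‖ < R' ∧ Bf z = c) →
      (S.card : ℝ) ≤ 1000 * ((1 + Real.log p + Real.log R) * p + R) := fun S hS =>
    card_le_of_borel_transform hp1 hf hp hB hR c S fun z hz =>
      ⟨(hS z hz).1.trans hR'R, (hS z hz).2⟩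
  have hfin : {z : ℂ | ‖z‖ < R' ∧ Bf z = c}.Finite := by
    by_contra hinf
    obtain ⟨t, ht, htc⟩ := Set.Infinite.exists_subset_card_eq hinf
      (⌊1000 * ((1 + Real.log p + Real.log R) * p + R)⌋₊ + 1)
    have h1 := hcard t fun z hz => ht hz
    rw [htc] at h1
    push_cast at h1
    exact absurd h1 (not_le.2 (Nat.lt_floor_add_one _))
  refine ⟨hfin, ?_⟩
  have h1 := hcard hfin.toFinset fun z hz => hfin.mem_toFinset.1 hz
  rw [← Set.ncard_eq_toFinset_card _ hfin] at h1
  have h2 := h1.trans (Int.le_ceil _)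
  exact_mod_cast h2
end

section
/- Let p ≥ 1 be an integer, A ≥ 1 a real number, and (a_k)_{k≥0} a sequence of complex numbers satisfying |a_k| ≤ A·k^{2p-1}·max_{1≤i≤p} |a_i| for all integers k ≥ p+1. Then for every real R ≥ 1 and every integer k ≥ p+1 one has |a_k|·R^k/k! ≤ (A·η/ν)·max_{1≤i≤p} |a_i|·R^i/i!, where η = max{ (3p)^{2p-1}·R^{3p}/(p+1)! , 3^{2p}·R^{2p+1}·e^R } and ν = min{ R , R^p/p! }. -/
/-- The values `Rⁱ/i!` for `1 ≤ i ≤ p` are bounded below by the smaller endpoint value. -/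
theorem min_le_pow_div_factorial {R : ℝ} (hR : 0 ≤ R) {i p : ℕ} (hi : 1 ≤ i) (hip : i ≤ p) :
    min R (R ^ p / (Nat.factorial p : ℝ)) ≤ R ^ i / (Nat.factorial i : ℝ) := by
  have hi0 : (0 : ℝ) < Nat.factorial i := by positivity
  rcases le_total (i : ℝ) R with h | h
  · refine (min_le_left _ _).trans ?_
    have hfact : Nat.factorial i ≤ i ^ (i - 1) := by
      have h1 := Nat.factorial_mul_descFactorial (Nat.sub_le i 1)
      rw [Nat.sub_sub_self hi, Nat.factorial_one, one_mul] at h1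
      exact h1 ▸ Nat.descFactorial_le_pow i (i - 1)
    rw [le_div_iff₀ hi0]
    calc R * (Nat.factorial i : ℝ) ≤ R * (i : ℝ) ^ (i - 1) := by gcongr; exact_mod_cast hfact
      _ ≤ R * R ^ (i - 1) := by gcongr
      _ = R ^ i := mul_pow_sub_one (by omega) R
  · refine (min_le_right _ _).trans ?_
    have hfact : (Nat.factorial i : ℝ) * (i : ℝ) ^ (p - i) ≤ Nat.factorial p := by
      exact_mod_cast Nat.factorial_mul_pow_sub_le_factorial hip
    rw [div_le_div_iff₀ (by positivity) hi0]
    calc R ^ p * (Nat.factorial i : ℝ)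
        = R ^ i * (Nat.factorial i * R ^ (p - i)) := by rw [← pow_mul_pow_sub R hip]; ring
      _ ≤ R ^ i * (Nat.factorial i * (i : ℝ) ^ (p - i)) := by gcongr
      _ ≤ R ^ i * Nat.factorial p := by gcongr

/-- If `3 m ≤ 2 k + 3`, then `k ^ m` is at most `3 ^ m` times the falling factorial
`k (k - 1) ⋯ (k - m + 1)`. -/
theorem pow_le_three_pow_mul_descFactorial {k m : ℕ} (h : 3 * m ≤ 2 * k + 3) :
    k ^ m ≤ 3 ^ m * k.descFactorial m :=
  calc k ^ m ≤ (3 * (k + 1 - m)) ^ m := Nat.pow_le_pow_left (by omega) m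
    _ = 3 ^ m * (k + 1 - m) ^ m := mul_pow ..
    _ ≤ 3 ^ m * k.descFactorial m := by gcongr; exact Nat.pow_sub_le_descFactorial k m

/-- The tail bound `kᵐ Rᵏ / k! ≤ (3 R)ᵐ e^R`. -/
theorem pow_mul_pow_div_factorial_le_exp {R : ℝ} (hR : 0 ≤ R) {k m : ℕ} (hmk : m ≤ k)
    (h : 3 * m ≤ 2 * k + 3) :
    (k : ℝ) ^ m * R ^ k / (Nat.factorial k : ℝ) ≤ 3 ^ m * R ^ m * Real.exp R := by
  have hk : (k : ℝ) ^ m ≤ 3 ^ m * (k.descFactorial m : ℝ) := by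
    exact_mod_cast pow_le_three_pow_mul_descFactorial h
  have hfact : (Nat.factorial k : ℝ) = Nat.factorial (k - m) * k.descFactorial m := by
    exact_mod_cast (Nat.factorial_mul_descFactorial hmk).symm
  have hdesc : (k.descFactorial m : ℝ) ≠ 0 := by
    exact_mod_cast (Nat.descFactorial_pos.mpr hmk).ne'
  calc (k : ℝ) ^ m * R ^ k / (Nat.factorial k : ℝ)
      ≤ 3 ^ m * (k.descFactorial m : ℝ) * R ^ k / (Nat.factorial k : ℝ) := by gcongr
    _ = 3 ^ m * R ^ m * (R ^ (k - m) / (Nat.factorial (k - m) : ℝ)) := by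
        rw [hfact, ← pow_mul_pow_sub R hmk]
        field_simp
    _ ≤ 3 ^ m * R ^ m * Real.exp R := by
        gcongr
        exact Real.pow_div_factorial_le_exp R hR (k - m)

/-- The weights `k^(2p-1) Rᵏ / k!` with `k ≥ p + 1` are bounded, by treating `k ≤ 3p` and
`k > 3p` separately. -/
theorem pow_mul_pow_div_factorial_le_max {R : ℝ} (hR : 1 ≤ R) {p k : ℕ} (hk : p + 1 ≤ k) :
    (k : ℝ) ^ (2 * p - 1) * R ^ k / (Nat.factorial k : ℝ) ≤
      max (((3 * p : ℕ) : ℝ) ^ (2 * p - 1) * R ^ (3 * p) / (Nat.factorial (p + 1) : ℝ))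
        ((3 : ℝ) ^ (2 * p) * R ^ (2 * p + 1) * Real.exp R) := by
  have hR0 : 0 ≤ R := zero_le_one.trans hR
  rcases le_or_gt k (3 * p) with h | h
  · refine le_max_of_le_left ?_
    gcongr
  · refine le_max_of_le_right
      ((pow_mul_pow_div_factorial_le_exp hR0 (by omega) (by omega)).trans ?_)
    gcongr
    · norm_num
    · omega
    · omega


/-- If the coefficients `aₖ` satisfy a Biernacki-type Taylor domination
`|aₖ| ≤ A·k^(2p-1)·max_{1≤i≤p}|aᵢ|` for `k ≥ p+1`, then for every `R ≥ 1` the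
rescaled Borel coefficients `|aₖ|·Rᵏ/k!` are dominated by `(A·η/ν)·max_{1≤i≤p}|aᵢ|·Rⁱ/i!`,
where `η = max{(3p)^(2p-1)·R^(3p)/(p+1)!, 3^(2p)·R^(2p+1)·e^R}` and `ν = min{R, R^p/p!}`. -/
theorem borel_taylor_domination (p : ℕ) (hp : 1 ≤ p) (A : ℝ) (hA : 1 ≤ A) (a : ℕ → ℂ)
    (hdom : ∀ k : ℕ, p + 1 ≤ k →
      ‖a k‖ ≤ A * (k : ℝ) ^ (2 * p - 1) *
        (Finset.Icc 1 p).sup' (Finset.nonempty_Icc.mpr hp) (fun i => ‖a i‖))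
    (R : ℝ) (hR : 1 ≤ R) (k : ℕ) (hk : p + 1 ≤ k) :
    ‖a k‖ * R ^ k / (Nat.factorial k : ℝ) ≤
      A * max (((3 * p : ℕ) : ℝ) ^ (2 * p - 1) * R ^ (3 * p) / (Nat.factorial (p + 1) : ℝ))
              ((3 : ℝ) ^ (2 * p) * R ^ (2 * p + 1) * Real.exp R) /
        min R (R ^ p / (Nat.factorial p : ℝ)) *
      (Finset.Icc 1 p).sup' (Finset.nonempty_Icc.mpr hp)
        (fun i => ‖a i‖ * R ^ i / (Nat.factorial i : ℝ)) := by
  have hR0 : 0 < R := zero_lt_one.trans_le hR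
  obtain ⟨j, hj, hmax⟩ := Finset.exists_mem_eq_sup' (Finset.nonempty_Icc.mpr hp) (fun i => ‖a i‖)
  have hak := hdom k hk
  rw [hmax] at hak
  rw [Finset.mem_Icc] at hj
  set η := max (((3 * p : ℕ) : ℝ) ^ (2 * p - 1) * R ^ (3 * p) / (Nat.factorial (p + 1) : ℝ))
    ((3 : ℝ) ^ (2 * p) * R ^ (2 * p + 1) * Real.exp R)
  set ν := min R (R ^ p / (Nat.factorial p : ℝ))
  have hν : 0 < ν := lt_min hR0 (by positivity)
  have hη : 0 ≤ η := le_max_of_le_right (by positivity)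
  have hA0 : 0 ≤ A := zero_le_one.trans hA
  calc ‖a k‖ * R ^ k / (Nat.factorial k : ℝ)
      ≤ A * (k : ℝ) ^ (2 * p - 1) * ‖a j‖ * R ^ k / (Nat.factorial k : ℝ) := by gcongr
    _ = A * ((k : ℝ) ^ (2 * p - 1) * R ^ k / (Nat.factorial k : ℝ)) * ‖a j‖ := by ring
    _ ≤ A * η * ‖a j‖ := by
        gcongr
        exact pow_mul_pow_div_factorial_le_max hR hk
    _ = A * η / ν * (‖a j‖ * ν) := by field_simp
    _ ≤ A * η / ν * (‖a j‖ * (R ^ j / (Nat.factorial j : ℝ))) := by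
        gcongr
        exact min_le_pow_div_factorial hR0.le hj.1 hj.2
    _ = A * η / ν * (‖a j‖ * R ^ j / (Nat.factorial j : ℝ)) := by ring
    _ ≤ _ := by
        gcongr
        exact Finset.le_sup' (fun i => ‖a i‖ * R ^ i / (Nat.factorial i : ℝ))
          (Finset.mem_Icc.mpr hj)
end
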